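/- Let A and C be real symmetric square matrices of the same dimension, both having all diagonal entries equal to 1 and all off-diagonal entries nonpositive, and let 0 < t ≤ 1. If A_{ij} ≥ t·C_{ij} + (1−t)·δ_{ij} for all i, j (where δ_{ij} is the Kronecker delta), i.e., A ⪰ tC + (1−t)I entrywise, then the smallest eigenvalue μ_A of A and the smallest eigenvalue μ_C of C satisfy μ_A ≥ t·μ_C + (1−t). In particular, if μ_C > 1 − 1/t, then A is positive definite. -/

import Mathlib

open Matrix in
/-- A real number bounds the eigenvalues of a real symmetric matrix from below iff it bounds the
Rayleigh quotient from below. -/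
lemma Matrix.IsHermitian.forall_le_eigenvalues_iff {ι : Type*} [Fintype ι] [DecidableEq ι]
    {A : Matrix ι ι ℝ} (hA : A.IsHermitian) (c : ℝ) :
    (∀ i, c ≤ hA.eigenvalues i) ↔ ∀ x : ι → ℝ, c * (x ⬝ᵥ x) ≤ x ⬝ᵥ A *ᵥ x := by
  constructor
  · intro h x
    have hB : (A - algebraMap ℝ (Matrix ι ι ℝ) c).IsHermitian :=
      hA.sub (by simp [IsHermitian, algebraMap_eq_diagonal])
    have hpos : (A - algebraMap ℝ (Matrix ι ι ℝ) c).PosSemidef := by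
      refine hB.posSemidef_iff_eigenvalues_nonneg.2 fun i => ?_
      have hmem := hB.eigenvalues_mem_spectrum_real i
      rw [← spectrum.sub_singleton_eq, Set.sub_singleton, Set.mem_image] at hmem
      obtain ⟨y, hy, hyi⟩ := hmem
      rw [hA.spectrum_real_eq_range_eigenvalues] at hy
      obtain ⟨j, rfl⟩ := hy
      simpa [← hyi] using h j
    have hx := hpos.dotProduct_mulVec_nonneg x
    rw [Algebra.algebraMap_eq_smul_one, sub_mulVec, smul_mulVec, one_mulVec, dotProduct_sub,
      dotProduct_smul, smul_eq_mul, star_trivial] at hx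
    linarith
  · intro h i
    have hv := h (hA.eigenvectorBasis i).ofLp
    have hnorm : (hA.eigenvectorBasis i).ofLp ⬝ᵥ (hA.eigenvectorBasis i).ofLp = 1 := by
      have := real_inner_self_eq_norm_sq (hA.eigenvectorBasis i)
      rwa [hA.eigenvectorBasis.norm_eq_one, one_pow, EuclideanSpace.inner_eq_star_dotProduct,
        star_trivial] at this
    rwa [hA.mulVec_eigenvectorBasis, dotProduct_smul, hnorm, smul_eq_mul, mul_one, mul_one] at hv

open Matrix in
/-- If the off-diagonal entries of `A` are nonpositive and `A` dominates `B` entrywise, then the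
quadratic form of `A` at `x` dominates the quadratic form of `B` at `|x|`. -/
lemma Matrix.abs_dotProduct_mulVec_abs_le {ι : Type*} [Fintype ι] {A B : Matrix ι ι ℝ}
    (hA : ∀ i j, i ≠ j → A i j ≤ 0) (hBA : ∀ i j, B i j ≤ A i j) (x : ι → ℝ) :
    |x| ⬝ᵥ B *ᵥ |x| ≤ x ⬝ᵥ A *ᵥ x := by
  simp only [dotProduct, mulVec, Finset.mul_sum, Pi.abs_apply]
  refine Finset.sum_le_sum fun i _ => Finset.sum_le_sum fun j _ => ?_
  calc |x i| * (B i j * |x j|) = |x i * x j| * B i j := by rw [abs_mul]; ring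
    _ ≤ |x i * x j| * A i j := mul_le_mul_of_nonneg_left (hBA i j) (abs_nonneg _)
    _ ≤ x i * x j * A i j := by
      obtain rfl | hij := eq_or_ne i j
      · rw [abs_mul_self]
      · exact mul_le_mul_of_nonpos_right (le_abs_self _) (hA i j hij)
    _ = x i * (A i j * x j) := by ring

/-- Let `A, C` be real symmetric matrices with `1`'s on the diagonal and nonpositive
off-diagonal entries, and let `0 < t ≤ 1`. If `A ⪰ tC + (1-t)I` entrywise, then the
smallest eigenvalues satisfy `μ_A ≥ t μ_C + (1-t)`; in particular if `μ_C > 1 - 1/t` then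
`A` is positive definite. -/
theorem smallest_eigenvalue_ge_of_entrywise {n : ℕ}
    (A C : Matrix (Fin (n + 1)) (Fin (n + 1)) ℝ)
    (hA : A.IsHermitian) (hC : C.IsHermitian)
    (hdA : ∀ i, A i i = 1) (hdC : ∀ i, C i i = 1)
    (hoA : ∀ i j, i ≠ j → A i j ≤ 0) (hoC : ∀ i j, i ≠ j → C i j ≤ 0)
    (t : ℝ) (ht0 : 0 < t) (ht1 : t ≤ 1)
    (hge : ∀ i j, t * C i j + (1 - t) * (if i = j then 1 else 0) ≤ A i j) :
    t * (⨅ i, hC.eigenvalues i) + (1 - t) ≤ (⨅ i, hA.eigenvalues i) ∧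
      ((1 - 1 / t < ⨅ i, hC.eigenvalues i) → A.PosDef) := by
  have key : t * (⨅ i, hC.eigenvalues i) + (1 - t) ≤ ⨅ i, hA.eigenvalues i := by
    refine le_ciInf ((hA.forall_le_eigenvalues_iff _).2 fun x => ?_)
    have hCx := (hC.forall_le_eigenvalues_iff _).1
      (fun i => ciInf_le (Set.finite_range hC.eigenvalues).bddBelow i) |x|
    have hAx := Matrix.abs_dotProduct_mulVec_abs_le (B := t • C + (1 - t) • 1) hoA
      (fun i j => by simpa [Matrix.one_apply] using hge i j) x
    have habs : |x| ⬝ᵥ |x| = x ⬝ᵥ x := by simp [dotProduct]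
    rw [Matrix.add_mulVec, Matrix.smul_mulVec, Matrix.smul_mulVec, Matrix.one_mulVec,
      dotProduct_add, dotProduct_smul, dotProduct_smul, habs, smul_eq_mul, smul_eq_mul] at hAx
    rw [habs] at hCx
    linarith [mul_le_mul_of_nonneg_left hCx ht0.le]
  refine ⟨key, fun h => hA.posDef_iff_eigenvalues_pos.2 fun i => ?_⟩
  have hi := ciInf_le (Set.finite_range hA.eigenvalues).bddBelow i
  have ht : t * (1 - 1 / t) = t - 1 := by field_simp
  linarith [mul_lt_mul_of_pos_left h ht0]
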